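/- Kuroda's translation theorem: for every formula φ of L_ICK: (1) φ ↔ tr(φ) is true at every world of every classical S5 model (i.e. φ ↔ tr(φ) ∈ CKS5); and (2) φ is true at every world of every classical S5 model if and only if tr(φ) is valid over the class of S5 epistemic frames (i.e. φ ∈ CKS5 iff tr(φ) ∈ ICKS5). -/

import Mathlib

namespace ICK

/-- Formulae of the language `L_ICK` over a type of agents and natural-number atoms. -/
inductive Formula (Agent : Type) : Type
  | bot : Formula Agent
  | atom : ℕ → Formula Agent
  | and : Formula Agent → Formula Agent → Formula Agent
  | or : Formula Agent → Formula Agent → Formula Agent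
  | imp : Formula Agent → Formula Agent → Formula Agent
  | know : Agent → Formula Agent → Formula Agent
  | ck : Formula Agent → Formula Agent

namespace Formula

variable {Agent : Type}

/-- `¬φ := φ → ⊥`. -/
def neg (φ : Formula Agent) : Formula Agent := φ.imp Formula.bot

/-- `⊤ := ⊥ → ⊥`. -/
def top : Formula Agent := Formula.imp Formula.bot Formula.bot

/-- `φ ↔ ψ := (φ → ψ) ∧ (ψ → φ)`. -/
def biimp (φ ψ : Formula Agent) : Formula Agent := (φ.imp ψ).and (ψ.imp φ)

end Formula

/-- The formula `E φ = ⋀_{a ∈ A} K_a φ` (everybody knows). -/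
noncomputable def Efml {Agent : Type} [Fintype Agent] (φ : Formula Agent) : Formula Agent :=
  (Finset.univ : Finset Agent).toList.foldr (fun a ψ => (Formula.know a φ).and ψ) Formula.top

/-- A birelational epistemic model: a poset `(W, ≤)` with triangle-confluent
modal relations `R a` and a `≤`-monotone valuation. -/
structure Model (Agent W : Type) where
  le : W → W → Prop
  R : Agent → W → W → Prop
  V : W → ℕ → Prop
  le_refl : ∀ w, le w w
  le_trans : ∀ w v u, le w v → le v u → le w u
  le_antisymm : ∀ w v, le w v → le v w → w = v
  tri : ∀ a w v u, le w v → R a v u → R a w u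
  mono : ∀ w v, le w v → ∀ n, V w n → V v n

/-- The union `R = ⋃_a R_a`. -/
def Model.Step {Agent W : Type} (M : Model Agent W) (w v : W) : Prop := ∃ a, M.R a w v

/-- Intuitionistic truth in an epistemic model. -/
def Sat {Agent W : Type} (M : Model Agent W) : Formula Agent → W → Prop
  | .bot, _ => False
  | .atom n, w => M.V w n
  | .and φ ψ, w => Sat M φ w ∧ Sat M ψ w
  | .or φ ψ, w => Sat M φ w ∨ Sat M ψ w
  | .imp φ ψ, w => ∀ v, M.le w v → Sat M φ v → Sat M ψ v
  | .know a φ, w => ∀ v, M.R a w v → Sat M φ v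
  | .ck φ, w => ∀ v, Relation.ReflTransGen M.Step w v → Sat M φ v

def Model.IsRefl {Agent W : Type} (M : Model Agent W) : Prop := ∀ a w, M.R a w w

def Model.IsTrans {Agent W : Type} (M : Model Agent W) : Prop :=
  ∀ a w v u, M.R a w v → M.R a v u → M.R a w u

def Model.IsSymm {Agent W : Type} (M : Model Agent W) : Prop :=
  ∀ a w v, M.R a w v → M.R a v w

def Model.IsS4 {Agent W : Type} (M : Model Agent W) : Prop := M.IsRefl ∧ M.IsTrans

def Model.IsS5 {Agent W : Type} (M : Model Agent W) : Prop := M.IsS4 ∧ M.IsSymm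

/-- Validity over the class of all epistemic frames. -/
def ValidAll (Agent : Type) (φ : Formula Agent) : Prop :=
  ∀ (W : Type) (M : Model Agent W) (w : W), Sat M φ w

/-- Validity over the class of reflexive epistemic frames. -/
def ValidRefl (Agent : Type) (φ : Formula Agent) : Prop :=
  ∀ (W : Type) (M : Model Agent W), M.IsRefl → ∀ w : W, Sat M φ w

/-- Validity over the class of S4 epistemic frames. -/
def ValidS4 (Agent : Type) (φ : Formula Agent) : Prop :=
  ∀ (W : Type) (M : Model Agent W), M.IsS4 → ∀ w : W, Sat M φ w

/-- Validity over the class of S5 epistemic frames. -/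
def ValidS5 (Agent : Type) (φ : Formula Agent) : Prop :=
  ∀ (W : Type) (M : Model Agent W), M.IsS5 → ∀ w : W, Sat M φ w

/-- A classical S5 model. -/
structure CModel (Agent W : Type) where
  R : Agent → W → W → Prop
  V : W → ℕ → Prop
  equiv : ∀ a, Equivalence (R a)

def CModel.Step {Agent W : Type} (M : CModel Agent W) (w v : W) : Prop := ∃ a, M.R a w v

/-- Classical truth in a classical S5 model. -/
def CSat {Agent W : Type} (M : CModel Agent W) : Formula Agent → W → Prop
  | .bot, _ => False
  | .atom n, w => M.V w n
  | .and φ ψ, w => CSat M φ w ∧ CSat M ψ w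
  | .or φ ψ, w => CSat M φ w ∨ CSat M ψ w
  | .imp φ ψ, w => CSat M φ w → CSat M ψ w
  | .know a φ, w => ∀ v, M.R a w v → CSat M φ v
  | .ck φ, w => ∀ v, Relation.ReflTransGen M.Step w v → CSat M φ v

/-- `CKS5`: truth at every world of every classical S5 model. -/
def CKS5 (Agent : Type) (φ : Formula Agent) : Prop :=
  ∀ (W : Type) (M : CModel Agent W) (w : W), CSat M φ w

/-- The auxiliary Kuroda-style map `τ`. -/
def tau {Agent : Type} : Formula Agent → Formula Agent
  | .bot => Formula.bot
  | .atom n => Formula.atom n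
  | .and φ ψ => (tau φ).and (tau ψ)
  | .or φ ψ => (tau φ).or (tau ψ)
  | .imp φ ψ => (tau φ).imp (tau ψ)
  | .know a φ => Formula.know a ((tau φ).neg.neg)
  | .ck φ => Formula.ck ((tau φ).neg.neg)

/-- The Kuroda translation `tr(φ) := ¬¬τ(φ)`. -/
def tr {Agent : Type} (φ : Formula Agent) : Formula Agent := (tau φ).neg.neg

section

variable {Agent W : Type}

@[simp]
theorem cSat_neg_neg (M : CModel Agent W) (φ : Formula Agent) (w : W) :
    CSat M φ.neg.neg w ↔ CSat M φ w := by
  simp [Formula.neg, CSat]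

theorem cSat_tau (M : CModel Agent W) (φ : Formula Agent) (w : W) :
    CSat M (tau φ) w ↔ CSat M φ w := by
  induction φ generalizing w <;> simp_all [tau, CSat]

theorem cSat_tr (M : CModel Agent W) (φ : Formula Agent) (w : W) :
    CSat M (tr φ) w ↔ CSat M φ w := by
  rw [tr, cSat_neg_neg, cSat_tau]

/-- A classical S5 model seen as an epistemic model with the discrete order. -/
def CModel.toModel (M : CModel Agent W) : Model Agent W where
  le := Eq
  R := M.R
  V := M.V
  le_refl _ := rfl
  le_trans _ _ _ := Eq.trans
  le_antisymm _ _ h _ := h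
  tri := by rintro a w _ u rfl h; exact h
  mono := by rintro w _ rfl n h; exact h

theorem CModel.toModel_isS5 (M : CModel Agent W) : M.toModel.IsS5 :=
  ⟨⟨fun a => (M.equiv a).refl, fun a _ _ _ => (M.equiv a).trans⟩,
    fun a _ _ => (M.equiv a).symm⟩

theorem CModel.sat_toModel (M : CModel Agent W) (φ : Formula Agent) (w : W) :
    Sat M.toModel φ w ↔ CSat M φ w := by
  induction φ generalizing w with
  | bot => rfl
  | atom n => rfl
  | and φ ψ ihφ ihψ => simp only [Sat, CSat, ihφ, ihψ]
  | or φ ψ ihφ ihψ => simp only [Sat, CSat, ihφ, ihψ]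
  | imp φ ψ ihφ ihψ =>
    simp only [Sat, CSat, ihφ, ihψ]
    exact ⟨fun h => h w rfl, fun h v hv => hv ▸ h⟩
  | know a φ ih =>
    simp only [Sat, CSat, ih]
    rfl
  | ck φ ih =>
    simp only [Sat, CSat, ih]
    rfl

theorem sat_neg_neg (M : Model Agent W) (φ : Formula Agent) (w : W) :
    Sat M φ.neg.neg w ↔ ∀ v, M.le w v → ∃ u, M.le v u ∧ Sat M φ u := by
  simp [Formula.neg, Sat]

namespace Model

/-- In an S5 model the order is contained in every accessibility relation. -/
theorem IsS5.rel_of_le {M : Model Agent W} (hM : M.IsS5) (a : Agent) {w v : W}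
    (h : M.le w v) : M.R a w v :=
  M.tri a w v v h (hM.1.1 a v)

/-- The world `v` decides the atom `n`: its truth value is constant above `v`. -/
def DecidesAtom (M : Model Agent W) (v : W) (n : ℕ) : Prop :=
  ∀ u, M.le v u → M.V u n → M.V v n

theorem DecidesAtom.of_le {M : Model Agent W} {v u : W} {n : ℕ} (h : M.DecidesAtom v n)
    (hvu : M.le v u) : M.DecidesAtom u n :=
  fun x hux hx => M.mono v u hvu n (h x (M.le_trans v u x hvu hux) hx)

theorem exists_decidesAtom (M : Model Agent W) (w : W) (n : ℕ) :
    ∃ v, M.le w v ∧ M.DecidesAtom v n := by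
  by_cases h : ∃ v, M.le w v ∧ M.V v n
  · obtain ⟨v, hwv, hv⟩ := h
    exact ⟨v, hwv, fun _ _ _ => hv⟩
  · exact ⟨w, M.le_refl w, fun u hwu hu => (h ⟨u, hwu, hu⟩).elim⟩

theorem exists_forall_decidesAtom (M : Model Agent W) (s : Finset ℕ) (w : W) :
    ∃ v, M.le w v ∧ ∀ n ∈ s, M.DecidesAtom v n := by
  induction s using Finset.induction_on with
  | empty => exact ⟨w, M.le_refl w, by simp⟩
  | insert n s _ ih =>
    obtain ⟨v, hwv, hv⟩ := ih
    obtain ⟨u, hvu, hu⟩ := M.exists_decidesAtom v n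
    refine ⟨u, M.le_trans w v u hwv hvu, fun m hm => ?_⟩
    rcases Finset.mem_insert.1 hm with rfl | hm
    · exact hu
    · exact (hv m hm).of_le hvu

/-- The classical model on the worlds of an S5 model `M`, with atoms evaluated along `d`. -/
def toCModel (M : Model Agent W) (hM : M.IsS5) (d : W → W) : CModel Agent W where
  R := M.R
  V w := M.V (d w)
  equiv a := ⟨hM.1.1 a, fun {_ _} => hM.2 a _ _, fun {_ _ _} => hM.1.2 a _ _ _⟩

end Model

/-- The finite set of atoms occurring in a formula. -/
def Formula.atoms : Formula Agent → Finset ℕ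
  | .bot => ∅
  | .atom n => {n}
  | .and φ ψ => φ.atoms ∪ ψ.atoms
  | .or φ ψ => φ.atoms ∪ ψ.atoms
  | .imp φ ψ => φ.atoms ∪ ψ.atoms
  | .know _ φ => φ.atoms
  | .ck φ => φ.atoms

/-- In an S5 model, a world deciding the atoms of `φ` decides `tau φ`. -/
theorem sat_tau_iff_of_le [Nonempty Agent] {M : Model Agent W} (hM : M.IsS5)
    {φ : Formula Agent} {v u : W} (hv : ∀ n ∈ φ.atoms, M.DecidesAtom v n) (hvu : M.le v u) :
    Sat M (tau φ) u ↔ Sat M (tau φ) v := by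
  induction φ generalizing u with
  | bot => rfl
  | atom n => exact ⟨hv n (by simp [Formula.atoms]) u hvu, M.mono v u hvu n⟩
  | and φ ψ ihφ ihψ =>
    have hφ := ihφ (fun n hn => hv n (Finset.mem_union_left _ hn)) hvu
    have hψ := ihψ (fun n hn => hv n (Finset.mem_union_right _ hn)) hvu
    simp only [tau, Sat, hφ, hψ]
  | or φ ψ ihφ ihψ =>
    have hφ := ihφ (fun n hn => hv n (Finset.mem_union_left _ hn)) hvu
    have hψ := ihψ (fun n hn => hv n (Finset.mem_union_right _ hn)) hvu
    simp only [tau, Sat, hφ, hψ]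
  | imp φ ψ ihφ ihψ =>
    have hφ : ∀ {x}, M.le v x → (Sat M (tau φ) x ↔ Sat M (tau φ) v) :=
      ihφ fun n hn => hv n (Finset.mem_union_left _ hn)
    have hψ : ∀ {x}, M.le v x → (Sat M (tau ψ) x ↔ Sat M (tau ψ) v) :=
      ihψ fun n hn => hv n (Finset.mem_union_right _ hn)
    simp only [tau, Sat]
    constructor
    · intro h x hvx hx
      exact (hψ hvx).2 ((hψ hvu).1 (h u (M.le_refl u) ((hφ hvu).2 ((hφ hvx).1 hx))))
    · exact fun h x hux => h x (M.le_trans v u x hvu hux)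
  | know a φ _ =>
    have hR := hM.rel_of_le a hvu
    exact ⟨fun h x hx => h x (hM.1.2 a _ _ _ (hM.2 a _ _ hR) hx),
      fun h x hx => h x (hM.1.2 a _ _ _ hR hx)⟩
  | ck φ _ =>
    obtain ⟨a⟩ := ‹Nonempty Agent›
    have hR := hM.rel_of_le a hvu
    exact ⟨fun h x hx => h x (.head ⟨a, hM.2 a _ _ hR⟩ hx),
      fun h x hx => h x (.head ⟨a, hR⟩ hx)⟩

theorem sat_neg_neg_tau_iff [Nonempty Agent] {M : Model Agent W} (hM : M.IsS5)
    {φ : Formula Agent} {v : W} (hv : ∀ n ∈ φ.atoms, M.DecidesAtom v n) :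
    Sat M (tau φ).neg.neg v ↔ Sat M (tau φ) v := by
  rw [sat_neg_neg]
  constructor
  · intro h
    obtain ⟨u, hvu, hu⟩ := h v (M.le_refl v)
    exact (sat_tau_iff_of_le hM hv hvu).1 hu
  · exact fun h u hvu => ⟨u, M.le_refl u, (sat_tau_iff_of_le hM hv hvu).2 h⟩

/-- If `d` picks above each world one that decides the atoms of `φ`, then classical truth of `φ`
in the model along `d` is truth of `tau φ` at the picked worlds. -/
theorem cSat_toCModel_iff [Nonempty Agent] {M : Model Agent W} (hM : M.IsS5) {d : W → W}
    (hd : ∀ w, M.le w (d w)) {φ : Formula Agent}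
    (hφ : ∀ w, ∀ n ∈ φ.atoms, M.DecidesAtom (d w) n) (w : W) :
    CSat (M.toCModel hM d) φ w ↔ Sat M (tau φ) (d w) := by
  induction φ generalizing w with
  | bot => rfl
  | atom n => rfl
  | and φ ψ ihφ ihψ =>
    have h₁ := ihφ (fun w n hn => hφ w n (Finset.mem_union_left _ hn)) w
    have h₂ := ihψ (fun w n hn => hφ w n (Finset.mem_union_right _ hn)) w
    simp only [tau, Sat, CSat, h₁, h₂]
  | or φ ψ ihφ ihψ =>
    have h₁ := ihφ (fun w n hn => hφ w n (Finset.mem_union_left _ hn)) w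
    have h₂ := ihψ (fun w n hn => hφ w n (Finset.mem_union_right _ hn)) w
    simp only [tau, Sat, CSat, h₁, h₂]
  | imp φ ψ ihφ ihψ =>
    have hl := fun w n hn => hφ w n (Finset.mem_union_left _ hn)
    have hr := fun w n hn => hφ w n (Finset.mem_union_right _ hn)
    simp only [tau, Sat, CSat, ihφ hl, ihψ hr]
    refine ⟨fun h x hx hxφ => ?_, fun h => h (d w) (M.le_refl _)⟩
    exact (sat_tau_iff_of_le hM (hr w) hx).2 (h ((sat_tau_iff_of_le hM (hl w) hx).1 hxφ))
  | know a φ ih =>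
    simp only [tau, Sat, CSat, ih hφ]
    have hR : ∀ x, M.R a x (d x) := fun x => hM.rel_of_le a (hd x)
    constructor
    · intro h x hx
      rw [sat_neg_neg]
      intro y hxy
      exact ⟨d y, hd y,
        h y (hM.1.2 a _ _ _ (hR w) (hM.1.2 a _ _ _ hx (hM.rel_of_le a hxy)))⟩
    · intro h x hx
      rw [← sat_neg_neg_tau_iff (φ := φ) hM (hφ x)]
      exact h (d x) (hM.1.2 a _ _ _ (hM.2 a _ _ (hR w)) (hM.1.2 a _ _ _ hx (hR x)))
  | ck φ ih =>
    simp only [tau, Sat, CSat, ih hφ]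
    obtain ⟨a⟩ := ‹Nonempty Agent›
    have hR : ∀ {x y}, M.le x y → M.Step x y := fun h => ⟨a, hM.rel_of_le a h⟩
    constructor
    · intro h x hx
      rw [sat_neg_neg]
      intro y hxy
      exact ⟨d y, hd y, h y (.head (hR (hd w)) (hx.tail (hR hxy)))⟩
    · intro h x hx
      rw [← sat_neg_neg_tau_iff (φ := φ) hM (hφ x)]
      exact h (d x) (.head ⟨a, hM.2 a _ _ (hM.rel_of_le a (hd w))⟩
        (Relation.ReflTransGen.tail hx (hR (hd x))))

theorem validS5_tr_of_cKS5 [Nonempty Agent] {φ : Formula Agent} (h : CKS5 Agent φ) :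
    ValidS5 Agent (tr φ) := by
  intro W M hM w
  choose d hd hφ using M.exists_forall_decidesAtom φ.atoms
  rw [tr, sat_neg_neg]
  exact fun v _ => ⟨d v, hd v, (cSat_toCModel_iff hM hd hφ v).1 (h W _ v)⟩

theorem cKS5_of_validS5_tr {φ : Formula Agent} (h : ValidS5 Agent (tr φ)) : CKS5 Agent φ :=
  fun W M w => (cSat_tr M φ w).1 <| (M.sat_toModel (tr φ) w).1 <| h W M.toModel M.toModel_isS5 w

end

/-- Kuroda's translation theorem. -/
theorem kuroda_translation (Agent : Type) [Fintype Agent] [Nonempty Agent]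
    (φ : Formula Agent) :
    CKS5 Agent (φ.biimp (tr φ)) ∧ (CKS5 Agent φ ↔ ValidS5 Agent (tr φ)) := by
  exact ⟨fun W M w => ⟨(cSat_tr M φ w).2, (cSat_tr M φ w).1⟩,
    validS5_tr_of_cKS5, cKS5_of_validS5_tr⟩

end ICK
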